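/- A connected chordal graph G has a dominating clique if and only if G has diameter at most 3. -/

import Mathlib

/-- A graph is chordal if every cycle of length at least 4 has a chord, i.e. an edge of the
graph joining two vertices of the cycle that is not an edge of the cycle. -/
def IsChordal {V : Type*} (G : SimpleGraph V) : Prop :=
  ∀ ⦃v : V⦄ (p : G.Walk v v), p.IsCycle → 4 ≤ p.length →
    ∃ a b, a ∈ p.support ∧ b ∈ p.support ∧ G.Adj a b ∧ s(a, b) ∉ p.edges

namespace SimpleGraph

variable {V : Type*} {G : SimpleGraph V}

/-- A set of vertices is cut-connected if every proper nonempty subset of it is joined by an edge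
to the rest of the set. -/
def CutConnected (G : SimpleGraph V) (A : Set V) : Prop :=
  ∀ T ⊆ A, T.Nonempty → T ≠ A → ∃ x ∈ T, ∃ y ∈ A, y ∉ T ∧ G.Adj x y

theorem cutConnected_singleton (a : V) : G.CutConnected {a} := by
  intro T hT hne hTA
  rcases Set.subset_singleton_iff_eq.1 hT with h | h
  · exact absurd h hne.ne_empty
  · exact absurd h hTA

theorem CutConnected.insert {A : Set V} (hA : G.CutConnected A) {a x : V} (ha : a ∈ A)
    (hax : G.Adj a x) : G.CutConnected (insert x A) := by
  intro T hT hne hTA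
  by_cases hTA' : A ⊆ T
  · have hx : x ∉ T := fun hx ↦ hTA (hT.antisymm (Set.insert_subset hx hTA'))
    exact ⟨a, hTA' ha, x, Set.mem_insert _ _, hx, hax⟩
  by_cases hTne : (T ∩ A).Nonempty
  · obtain ⟨u, hu, v, hv, hvT, huv⟩ := hA (T ∩ A) Set.inter_subset_right hTne
      (fun h ↦ hTA' (Set.inter_eq_right.1 h))
    exact ⟨u, hu.1, v, Set.mem_insert_of_mem _ hv, fun h ↦ hvT ⟨h, hv⟩, huv⟩
  · have haT : a ∉ T := fun h ↦ hTne ⟨a, h, ha⟩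
    obtain ⟨t, ht⟩ := hne
    rcases hT ht with rfl | htA
    · exact ⟨t, ht, a, Set.mem_insert_of_mem _ ha, haT, hax.symm⟩
    · exact absurd ⟨t, ht, htA⟩ hTne

theorem cutConnected_insert_neighborSet (v : V) :
    G.CutConnected (insert v (G.neighborSet v)) := by
  intro T hT hne hTA
  by_cases hv : v ∈ T
  · obtain ⟨y, hy, hyT⟩ := Set.exists_of_ssubset (hT.ssubset_of_ne hTA)
    rcases hy with rfl | hy'
    · exact absurd hv hyT
    · exact ⟨v, hv, y, Or.inr hy', hyT, hy'⟩
  · obtain ⟨t, ht⟩ := hne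
    rcases hT ht with rfl | h
    · exact absurd ht hv
    · exact ⟨t, ht, v, Set.mem_insert _ _, hv, G.adj_symm h⟩

theorem CutConnected.exists_walk {A : Set V} (hA : G.CutConnected A) {x y : V} (hx : x ∈ A)
    (hy : y ∈ A) : ∃ p : G.Walk x y, ∀ v ∈ p.support, v ∈ A := by
  by_contra hxy
  obtain ⟨u, ⟨hu, p, hp⟩, v, hv, hvT, huv⟩ :=
    hA {t | t ∈ A ∧ ∃ p : G.Walk x t, ∀ v ∈ p.support, v ∈ A} (fun t ht ↦ ht.1)
      ⟨x, hx, Walk.nil, by simpa using hx⟩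
      (fun h ↦ hxy (h.symm.subset hy).2)
  refine hvT ⟨hv, p.concat huv, fun w hw ↦ ?_⟩
  rw [Walk.support_concat, List.mem_append] at hw
  rcases hw with hw | hw
  · exact hp w hw
  · rw [List.mem_singleton.1 hw]
    exact hv

/-- A walk of minimal length among those staying in a given set has no chords. -/
theorem Walk.mem_edges_of_adj_of_minimal {B : Set V} {x y : V} (p : G.Walk x y)
    (hp : ∀ v ∈ p.support, v ∈ B)
    (hmin : ∀ q : G.Walk x y, (∀ v ∈ q.support, v ∈ B) → p.length ≤ q.length)
    {a b : V} (ha : a ∈ p.support) (hb : b ∈ p.support) (hab : G.Adj a b) :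
    s(a, b) ∈ p.edges := by
  obtain ⟨i, rfl, hi⟩ := Walk.mem_support_iff_exists_getVert.1 ha
  obtain ⟨j, rfl, hj⟩ := Walk.mem_support_iff_exists_getVert.1 hb
  wlog hij : i < j generalizing i j
  · have hne : i ≠ j := by
      rintro rfl
      exact hab.ne rfl
    rw [Sym2.eq_swap]
    exact this j hj hb i hi ha hab.symm (by omega)
  have hle := hmin ((p.take i).append (Walk.cons hab (p.drop j))) (by
    intro v hv
    rw [Walk.mem_support_append_iff, Walk.support_cons, List.mem_cons] at hv
    rcases hv with hv | rfl | hv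
    · exact hp v (p.isSubwalk_take i |>.support_subset hv)
    · exact hp _ ha
    · exact hp v (p.isSubwalk_drop j |>.support_subset hv))
  rw [Walk.length_append, Walk.length_cons, Walk.take_length, Walk.drop_length] at hle
  obtain rfl : j = i + 1 := by omega
  exact p.mk_mem_edges_iff_exists.2 ⟨i, by omega, rfl⟩

end SimpleGraph

open SimpleGraph

/-- In a chordal graph, two neighbours of a vertex `z` that are both attached to a connected set
containing no neighbour of `z` are adjacent. -/
theorem IsChordal.adj_of_cutConnected {V : Type*} {G : SimpleGraph V} (hG : IsChordal G)
    {A : Set V} (hA : G.CutConnected A) {x y z a b : V} (hzA : z ∉ A)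
    (hz : ∀ c ∈ A, ¬ G.Adj z c) (hzx : G.Adj z x) (hzy : G.Adj z y) (ha : a ∈ A) (hb : b ∈ A)
    (hax : G.Adj a x) (hby : G.Adj b y) (hne : x ≠ y) : G.Adj x y := by
  classical
  by_contra hxy
  set B : Set V := insert y (insert x A) with hB
  have hBconn : G.CutConnected B := (hA.insert ha hax).insert (Set.mem_insert_of_mem _ hb) hby
  have hzB : z ∉ B := by
    simp only [hB, Set.mem_insert_iff, not_or]
    exact ⟨hzy.ne, hzx.ne, hzA⟩
  obtain ⟨p₀, hp₀⟩ := hBconn.exists_walk (x := x) (y := y) (by simp [hB]) (by simp [hB])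
  obtain ⟨p₁, hp₁, hmin₁⟩ := exists_minimalFor_of_wellFoundedLT
    (fun p : G.Walk x y ↦ ∀ v ∈ p.support, v ∈ B) Walk.length ⟨p₀, hp₀⟩
  obtain ⟨p, hpath, hp, hmin⟩ : ∃ p : G.Walk x y, p.IsPath ∧ (∀ v ∈ p.support, v ∈ B) ∧
      ∀ q : G.Walk x y, (∀ v ∈ q.support, v ∈ B) → p.length ≤ q.length := by
    refine ⟨p₁.bypass, p₁.bypass_isPath, fun v hv ↦ hp₁ v (p₁.support_bypass_subset_support hv),
      fun q hq ↦ p₁.length_bypass_le_length.trans ?_⟩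
    rcases le_total p₁.length q.length with h | h
    · exact h
    · exact hmin₁ hq h
  have hzp : z ∉ p.support := fun h ↦ hzB (hp z h)
  have hlen : 2 ≤ p.length := by
    rcases Nat.lt_or_ge p.length 2 with h | h
    · interval_cases hl : p.length
      · exact absurd (Walk.eq_of_length_eq_zero hl) hne
      · exact absurd (Walk.adj_of_length_eq_one hl) hxy
    · exact h
  have hcyc : (Walk.cons hzx (p.concat hzy.symm)).IsCycle := by
    rw [Walk.cons_isCycle_iff]
    refine ⟨hpath.concat hzp hzy.symm, fun h ↦ ?_⟩
    rw [Walk.edges_concat, List.concat_eq_append, List.mem_append, List.mem_singleton] at h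
    rcases h with h | h
    · exact hzp (p.fst_mem_support_of_mem_edges h)
    · rw [Sym2.eq_swap, Sym2.congr_left] at h
      exact hne h
  have hchord_z : ∀ c ∈ p.support, G.Adj z c → c = x ∨ c = y := by
    intro c hc hzc
    rcases hp c hc with h | h | h
    · exact Or.inr h
    · exact Or.inl h
    · exact absurd hzc (hz c h)
  obtain ⟨c, d, hc, hd, hcd, hnot⟩ := hG _ hcyc (by
    rw [Walk.length_cons, Walk.length_concat]; omega)
  have hsupp : ∀ w ∈ (Walk.cons hzx (p.concat hzy.symm)).support, w = z ∨ w ∈ p.support := by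
    intro w hw
    simp only [Walk.support_cons, Walk.support_concat, List.mem_cons, List.mem_append,
      List.not_mem_nil, or_false] at hw
    tauto
  simp only [Walk.edges_cons, Walk.edges_concat, List.concat_eq_append, List.mem_cons,
    List.mem_append, List.not_mem_nil, or_false, not_or] at hnot
  rcases hsupp c hc with rfl | hc' <;> rcases hsupp d hd with rfl | hd'
  · exact hcd.ne rfl
  · rcases hchord_z d hd' hcd with rfl | rfl
    · exact hnot.1 rfl
    · exact hnot.2.2 Sym2.eq_swap
  · rcases hchord_z c hc' hcd.symm with rfl | rfl
    · exact hnot.1 Sym2.eq_swap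
    · exact hnot.2.2 rfl
  · exact hnot.2.1 (p.mem_edges_of_adj_of_minimal hp hmin hc' hd' hcd)

/-- Dirac's theorem: every nonempty finite induced subgraph of a chordal graph has a simplicial
vertex. -/
theorem IsChordal.exists_simplicial {V : Type*} {G : SimpleGraph V} (hG : IsChordal G)
    (W : Finset V) (hW : W.Nonempty) :
    ∃ s ∈ W, ∀ x ∈ W, ∀ y ∈ W, G.Adj s x → G.Adj s y → x ≠ y → G.Adj x y := by
  classical
  induction W using Finset.strongInduction with
  | H W ih =>
  by_cases hcompl : ∀ x ∈ W, ∀ y ∈ W, x ≠ y → G.Adj x y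
  · obtain ⟨s, hs⟩ := hW
    exact ⟨s, hs, fun x hx y hy _ _ ↦ hcompl x hx y hy⟩
  push Not at hcompl
  obtain ⟨a, ha, b, hb, hab, hnab⟩ := hcompl
  let far (A : Finset V) : Finset V := {r ∈ W | r ∉ A ∧ ∀ c ∈ A, ¬ G.Adj c r}
  obtain ⟨A, hAmem, hAmax⟩ := Finset.exists_max_image
    (W.powerset.filter fun A : Finset V ↦
      A.Nonempty ∧ G.CutConnected (A : Set V) ∧ (far A).Nonempty) Finset.card
    ⟨{a}, by
      simp only [Finset.mem_filter, Finset.mem_powerset, Finset.singleton_subset_iff,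
        Finset.singleton_nonempty, Finset.coe_singleton, true_and]
      exact ⟨ha, cutConnected_singleton a, b, by simp [far, hb, hab.symm, hnab]⟩⟩
  simp only [Finset.mem_filter, Finset.mem_powerset, and_imp] at hAmem hAmax
  obtain ⟨hAW, ⟨a', ha'⟩, hAconn, hfar⟩ := hAmem
  have hfarW : far A ⊂ W := Finset.filter_ssubset.2 ⟨a', hAW ha', by simp [ha']⟩
  obtain ⟨z, hzR, hz⟩ := ih _ hfarW hfar
  obtain ⟨hzW, hzA, hzadj⟩ := Finset.mem_filter.1 hzR
  have hboundary : ∀ x ∈ W, x ∉ far A → G.Adj z x →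
      (∃ c ∈ A, G.Adj c x) ∧ ∀ r ∈ far A, G.Adj x r := by
    intro x hx hxR hzx
    have hxA : x ∉ A := fun h ↦ hzadj x h hzx.symm
    obtain ⟨c, hc, hcx⟩ : ∃ c ∈ A, G.Adj c x := by
      by_contra! h
      exact hxR (Finset.mem_filter.2 ⟨hx, hxA, h⟩)
    refine ⟨⟨c, hc, hcx⟩, fun r hr ↦ ?_⟩
    by_contra hxr
    obtain ⟨hrW, hrA, hradj⟩ := Finset.mem_filter.1 hr
    have hrx : r ≠ x := by
      rintro rfl
      exact hxR hr
    have hle := hAmax (insert x A) (Finset.insert_subset hx hAW) (Finset.insert_nonempty _ _)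
      (by rw [Finset.coe_insert]; exact hAconn.insert (Finset.mem_coe.2 hc) hcx)
      ⟨r, Finset.mem_filter.2 ⟨hrW, by simp [hrx, hrA], by
        intro d hd
        rcases Finset.mem_insert.1 hd with rfl | hd
        · exact hxr
        · exact hradj d hd⟩⟩
    rw [Finset.card_insert_of_notMem hxA] at hle
    omega
  refine ⟨z, hzW, fun x hx y hy hzx hzy hxy ↦ ?_⟩
  by_cases hxR : x ∈ far A <;> by_cases hyR : y ∈ far A
  · exact hz x hxR y hyR hzx hzy hxy
  · exact ((hboundary y hy hyR hzy).2 x hxR).symm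
  · exact (hboundary x hx hxR hzx).2 y hyR
  · obtain ⟨c, hc, hcx⟩ := (hboundary x hx hxR hzx).1
    obtain ⟨d, hd, hdy⟩ := (hboundary y hy hyR hzy).1
    exact hG.adj_of_cutConnected hAconn (Finset.mem_coe.not.2 hzA)
      (fun e he h ↦ hzadj e he h.symm) hzx hzy hc hd hcx hdy hxy

/-- In a chordal graph, every bramble inside a finite set of vertices is covered by a clique. -/
theorem IsChordal.exists_isClique_cover {V ι : Type*} {G : SimpleGraph V} (hG : IsChordal G)
    (W : Finset V) (F : ι → Set V) (hFW : ∀ i, F i ⊆ W) (hne : ∀ i, (F i).Nonempty)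
    (hconn : ∀ i, G.CutConnected (F i))
    (htouch : ∀ i j, ∃ a ∈ F i, ∃ b ∈ F j, a = b ∨ G.Adj a b) :
    ∃ K : Set V, G.IsClique K ∧ ∀ i, (K ∩ F i).Nonempty := by
  classical
  induction W using Finset.strongInduction generalizing F with
  | H W ih =>
  rcases W.eq_empty_or_nonempty with rfl | hW
  · refine ⟨∅, by simp, fun i ↦ ?_⟩
    obtain ⟨x, hx⟩ := hne i
    simpa using hFW i hx
  obtain ⟨s, hsW, hs⟩ := hG.exists_simplicial W hW
  by_cases hsingle : ∃ i, F i = {s}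
  · obtain ⟨i, hi⟩ := hsingle
    refine ⟨{v | v ∈ W ∧ (s = v ∨ G.Adj s v)}, ?_, fun j ↦ ?_⟩
    · rintro x ⟨hx, rfl | hsx⟩ y ⟨hy, rfl | hsy⟩ hxy
      · exact absurd rfl hxy
      · exact hsy
      · exact hsx.symm
      · exact hs x hx y hy hsx hsy hxy
    · obtain ⟨a, ha, b, hb, hab⟩ := htouch i j
      rw [hi, Set.mem_singleton_iff] at ha
      subst ha
      exact ⟨b, ⟨hFW j hb, hab⟩, hb⟩
  push Not at hsingle
  have hnbr : ∀ i, s ∈ F i → ∃ t ∈ F i, t ≠ s ∧ G.Adj s t := by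
    intro i hi
    obtain ⟨x, rfl, y, hy, hys, hxy⟩ := hconn i {s} (Set.singleton_subset_iff.2 hi)
      (Set.singleton_nonempty s) (hsingle i).symm
    exact ⟨y, hy, hys, hxy⟩
  obtain ⟨K, hK, hKF⟩ := ih (W.erase s) (Finset.erase_ssubset hsW) (fun i ↦ F i \ {s})
    (fun i x hx ↦ by
      rw [Finset.coe_erase]
      exact ⟨hFW i hx.1, hx.2⟩)
    (fun i ↦ by
      by_cases hi : s ∈ F i
      · obtain ⟨t, ht, hts, -⟩ := hnbr i hi
        exact ⟨t, ht, hts⟩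
      · obtain ⟨t, ht⟩ := hne i
        exact ⟨t, ht, fun h ↦ hi (Set.mem_singleton_iff.1 h ▸ ht)⟩)
    (fun i T hT hTne hTA ↦ by
      have hsT : s ∉ T := fun h ↦ (hT h).2 rfl
      have hTF : T ⊆ F i := hT.trans Set.sdiff_subset
      obtain ⟨z, hz, hzT⟩ := Set.exists_of_ssubset (hT.ssubset_of_ne hTA)
      obtain ⟨x, hx, y, hy, hyT, hxy⟩ := hconn i T hTF hTne (by
        rintro rfl
        exact hzT hz.1)
      by_cases hys : y = s
      · subst hys
        obtain ⟨u, hu, v, hv, hvT, huv⟩ := hconn i (insert y T) (Set.insert_subset hy hTF)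
          (Set.insert_nonempty _ _) (fun h ↦ by
            rcases h.symm.subset hz.1 with h | h
            · exact hz.2 h
            · exact hzT h)
        rw [Set.mem_insert_iff, not_or] at hvT
        rcases hu with rfl | hu
        · refine ⟨x, hx, v, ⟨hv, hvT.1⟩, hvT.2, ?_⟩
          exact hs x (hFW i (hTF hx)) v (hFW i hv) hxy.symm huv (by
            rintro rfl
            exact hvT.2 hx)
        · exact ⟨u, hu, v, ⟨hv, hvT.1⟩, hvT.2, huv⟩
      · exact ⟨x, hx, y, ⟨hy, hys⟩, hyT, hxy⟩)
    (fun i j ↦ by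
      have key : ∀ u ∈ W, ∀ v ∈ W, G.Adj s u → G.Adj s v → u = v ∨ G.Adj u v :=
        fun u hu v hv hsu hsv ↦ or_iff_not_imp_left.2 (hs u hu v hv hsu hsv)
      obtain ⟨a, ha, b, hb, hab⟩ := htouch i j
      by_cases has : a = s <;> by_cases hbs : b = s
      · subst has hbs
        obtain ⟨t, ht, hts, hst⟩ := hnbr i ha
        obtain ⟨u, hu, hus, hsu⟩ := hnbr j hb
        exact ⟨t, ⟨ht, hts⟩, u, ⟨hu, hus⟩, key t (hFW i ht) u (hFW j hu) hst hsu⟩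
      · subst has
        obtain ⟨t, ht, hts, hst⟩ := hnbr i ha
        have hsb := hab.resolve_left (Ne.symm hbs)
        exact ⟨t, ⟨ht, hts⟩, b, ⟨hb, hbs⟩, key t (hFW i ht) b (hFW j hb) hst hsb⟩
      · subst hbs
        obtain ⟨t, ht, hts, hst⟩ := hnbr j hb
        have hsa := (hab.resolve_left has).symm
        exact ⟨a, ⟨ha, has⟩, t, ⟨ht, hts⟩, key a (hFW i ha) t (hFW j ht) hsa hst⟩
      · exact ⟨a, ⟨ha, has⟩, b, ⟨hb, hbs⟩, hab⟩)
  exact ⟨K, hK, fun i ↦ (hKF i).mono (Set.inter_subset_inter_right _ Set.sdiff_subset)⟩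

/-- Vertices at distance at most three have touching closed neighbourhoods. -/
theorem SimpleGraph.Walk.exists_touching_of_length_le_three {V : Type*} {G : SimpleGraph V}
    {u v : V} (p : G.Walk u v) (hp : p.length ≤ 3) :
    ∃ a ∈ insert u (G.neighborSet u), ∃ b ∈ insert v (G.neighborSet v), a = b ∨ G.Adj a b := by
  match p, hp with
  | .nil, _ => exact ⟨u, Or.inl rfl, u, Or.inl rfl, Or.inl rfl⟩
  | .cons h .nil, _ => exact ⟨u, Or.inl rfl, v, Or.inl rfl, Or.inr h⟩
  | .cons h (.cons h' .nil), _ => exact ⟨_, Or.inr h, _, Or.inl rfl, Or.inr h'⟩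
  | .cons h (.cons h' (.cons h'' .nil)), _ => exact ⟨_, Or.inr h, _, Or.inr h''.symm, Or.inr h'⟩
  | .cons _ (.cons _ (.cons _ (.cons _ q))), hp =>
    simp only [Walk.length_cons] at hp
    omega

/-- A connected chordal graph has a dominating clique iff it has diameter at most 3. -/
theorem stmt8 {V : Type*} [Fintype V] (G : SimpleGraph V)
    (hconn : G.Connected) (hchordal : IsChordal G) :
    (∃ D : Set V, G.IsClique D ∧ ∀ v ∉ D, ∃ u ∈ D, G.Adj u v) ↔ G.diam ≤ 3 := by
  have := hconn.nonempty
  constructor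
  · rintro ⟨D, hD, hdom⟩
    have hnear : ∀ v, ∃ u ∈ D, G.dist v u ≤ 1 := by
      intro v
      by_cases hv : v ∈ D
      · exact ⟨v, hv, by simp⟩
      · obtain ⟨u, hu, huv⟩ := hdom v hv
        exact ⟨u, hu, (dist_eq_one_iff_adj.2 huv.symm).le⟩
    obtain ⟨u, v, huv⟩ := G.exists_dist_eq_diam
    rw [← huv]
    obtain ⟨a, ha, hua⟩ := hnear u
    obtain ⟨b, hb, hvb⟩ := hnear v
    have hab : G.dist a b ≤ 1 := by
      rcases eq_or_ne a b with rfl | h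
      · simp
      · exact (dist_eq_one_iff_adj.2 (hD ha hb h)).le
    have h₁ := hconn.dist_triangle (u := u) (v := a) (w := v)
    have h₂ := hconn.dist_triangle (u := a) (v := b) (w := v)
    rw [dist_comm (u := b)] at h₂
    omega
  · intro hdiam
    obtain ⟨K, hK, hKF⟩ := hchordal.exists_isClique_cover Finset.univ
      (fun v ↦ insert v (G.neighborSet v)) (fun v ↦ by simp) (fun v ↦ Set.insert_nonempty _ _)
      cutConnected_insert_neighborSet (fun u v ↦ by
        obtain ⟨p, hp⟩ := hconn.exists_walk_length_eq_dist u v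
        refine p.exists_touching_of_length_le_three ?_
        rw [hp]
        exact (dist_le_diam (connected_iff_ediam_ne_top.1 hconn)).trans hdiam)
    refine ⟨K, hK, fun v hv ↦ ?_⟩
    obtain ⟨u, huK, rfl | huv⟩ := hKF v
    · exact absurd huK hv
    · exact ⟨u, huK, G.adj_symm huv⟩
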